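/- arXiv:2405.13308 — 7 statements merged into one kernel-verified Lean document; each statement's English description precedes it below -/
import Mathlib

section
/- Let G be a group, V a real vector space with an alternating bilinear form ω, ρ: G → GL(V) a group homomorphism with ω(ρ(g)x, ρ(g)y) = ω(x, y) for all g ∈ G and x, y ∈ V, and τ: G → V a 1-cocycle, i.e. τ(g h) = τ(g) + ρ(g)τ(h) for all g, h ∈ G. Define c: G × G → ℝ by c(g₁, g₂) = ½ ω(τ(g₁), τ(g₁ g₂)). Then c satisfies the group 2-cocycle identity: c(g₁, g₂) + c(g₁ g₂, g₃) = c(g₂, g₃) + c(g₁, g₂ g₃) for all g₁, g₂, g₃ ∈ G. Equivalently, G × ℝ with multiplication (g₁, z₁)·(g₂, z₂) = (g₁ g₂, z₁ + z₂ + c(g₁, g₂)) is a group (a central ℝ-extension of G). -/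
/-- Let `G` be a group, `V` a real vector space with an alternating bilinear
form `ω`, `ρ : G → GL(V)` a homomorphism preserving `ω`, and `τ : G → V` a 1-cocycle,
i.e. `τ(gh) = τ(g) + ρ(g)τ(h)`. Define `c(g₁, g₂) = ½ ω(τ(g₁), τ(g₁g₂))`. Then `c`
satisfies the group 2-cocycle identity
`c(g₁, g₂) + c(g₁g₂, g₃) = c(g₂, g₃) + c(g₁, g₂g₃)` (equivalently, `G × ℝ` with
multiplication twisted by `c` is a central ℝ-extension of `G`). -/
theorem affine_symplectic_group_two_cocycle {G V : Type*} [Group G] [AddCommGroup V]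
    [Module ℝ V]
    (ω : V →ₗ[ℝ] V →ₗ[ℝ] ℝ) (halt : ∀ x : V, ω x x = 0)
    (ρ : G →* (V ≃ₗ[ℝ] V))
    (hρ : ∀ (g : G) (x y : V), ω (ρ g x) (ρ g y) = ω x y)
    (τ : G → V) (hτ : ∀ g h : G, τ (g * h) = τ g + ρ g (τ h)) :
    ∀ g₁ g₂ g₃ : G,
      (1 / 2 : ℝ) * ω (τ g₁) (τ (g₁ * g₂))
        + (1 / 2 : ℝ) * ω (τ (g₁ * g₂)) (τ (g₁ * g₂ * g₃))
      = (1 / 2 : ℝ) * ω (τ g₂) (τ (g₂ * g₃))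
        + (1 / 2 : ℝ) * ω (τ g₁) (τ (g₁ * (g₂ * g₃))) := by
  have key (g h : G) : ω (τ g) (τ (g * h)) = ω (τ g) (ρ g (τ h)) := by
    rw [hτ, map_add, halt, zero_add]
  intro g₁ g₂ g₃
  rw [key, key, key, key, hτ g₁ g₂, hτ g₂ g₃, map_mul, LinearEquiv.mul_apply, map_add,
    LinearMap.add_apply, hρ, map_add, map_add]
  ring
end

section
/- Fix m ∈ ℝ. On the set of quadruples g = (R, v, a, τ) with R a 3×3 real orthogonal matrix and v, a ∈ ℝ³, τ ∈ ℝ, define the (Galilean) multiplication (R₁, v₁, a₁, τ₁)·(R₂, v₂, a₂, τ₂) = (R₁R₂, v₁ + R₁v₂, a₁ + R₁a₂ + τ₂ v₁, τ₁ + τ₂), and define the Bargmann cochain c(g₁, g₂) = (m/2)·(⟨v₁, R₁a₂⟩ − ⟨a₁, R₁v₂⟩ − τ₂ ⟨v₁, R₁v₂⟩), where ⟨·,·⟩ is the Euclidean inner product on ℝ³. Then c satisfies the group 2-cocycle identity c(g₁, g₂) + c(g₁g₂, g₃) = c(g₂, g₃) + c(g₁, g₂g₃) for all such quadruples g₁,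 g₂, g₃. -/
open scoped Matrix

/-- An element `(R, v, a, τ)` of the Galilean group: `R` a linear map of `ℝ³`
(assumed orthogonal in the theorem), `v` a boost, `a` a space translation,
`τ` a time translation. -/
structure GalQuad where
  R : (Fin 3 → ℝ) →ₗ[ℝ] (Fin 3 → ℝ)
  v : Fin 3 → ℝ
  a : Fin 3 → ℝ
  τ : ℝ

/-- The Galilean multiplication
`(R₁, v₁, a₁, τ₁)·(R₂, v₂, a₂, τ₂) = (R₁R₂, v₁ + R₁v₂, a₁ + R₁a₂ + τ₂ v₁, τ₁ + τ₂)`. -/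
def GalQuad.mul (g₁ g₂ : GalQuad) : GalQuad :=
  ⟨g₁.R ∘ₗ g₂.R, g₁.v + g₁.R g₂.v, g₁.a + g₁.R g₂.a + g₂.τ • g₁.v, g₁.τ + g₂.τ⟩

/-- The Bargmann cochain
`c(g₁, g₂) = (m/2)·(⟨v₁, R₁a₂⟩ − ⟨a₁, R₁v₂⟩ − τ₂⟨v₁, R₁v₂⟩)`. -/
noncomputable def bargmannCochain (m : ℝ) (g₁ g₂ : GalQuad) : ℝ :=
  (m / 2) * (g₁.v ⬝ᵥ g₁.R g₂.a - g₁.a ⬝ᵥ g₁.R g₂.v - g₂.τ * (g₁.v ⬝ᵥ g₁.R g₂.v))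

/-- The Bargmann cochain satisfies the group 2-cocycle identity
`c(g₁, g₂) + c(g₁g₂, g₃) = c(g₂, g₃) + c(g₁, g₂g₃)` for all Galilean quadruples with
orthogonal rotation parts. -/
theorem bargmann_two_cocycle (m : ℝ) (g₁ g₂ g₃ : GalQuad)
    (h₁ : ∀ x y : Fin 3 → ℝ, g₁.R x ⬝ᵥ g₁.R y = x ⬝ᵥ y)
    (h₂ : ∀ x y : Fin 3 → ℝ, g₂.R x ⬝ᵥ g₂.R y = x ⬝ᵥ y)
    (h₃ : ∀ x y : Fin 3 → ℝ, g₃.R x ⬝ᵥ g₃.R y = x ⬝ᵥ y) :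
    bargmannCochain m g₁ g₂ + bargmannCochain m (g₁.mul g₂) g₃
      = bargmannCochain m g₂ g₃ + bargmannCochain m g₁ (g₂.mul g₃) := by
  unfold bargmannCochain GalQuad.mul
  simp only [LinearMap.comp_apply, map_add, map_smul, add_dotProduct, dotProduct_add,
    smul_dotProduct, dotProduct_smul, smul_eq_mul]
  rw [← h₁ g₂.v (g₂.R g₃.a), ← h₁ g₂.a (g₂.R g₃.v), ← h₁ g₂.v (g₂.R g₃.v)]
  ring
end

section
/- Let m, s ∈ ℝ with m ≠ 0 and let q, p, x ∈ ℝ³ with ‖x‖ = 1 satisfy the critical-point equations: (1) p × (q × p − s·x) + 2m²·q = 0, (2) (q × p − s·x) × q + 2p + m⁻²‖p‖²·p = 0, and (3) s·((q × p − s·x) × x) = 0. If q × p = 0, then q = 0 and p = 0. -/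
open scoped Matrix

/-- Let `m, s ∈ ℝ` with `m ≠ 0` and let `q, p, x ∈ ℝ³` with `‖x‖ = 1`
satisfy the critical-point equations
(1) `p × (q × p − s·x) + 2m²·q = 0`,
(2) `(q × p − s·x) × q + 2p + m⁻²‖p‖²·p = 0`,
(3) `s·((q × p − s·x) × x) = 0`.
If `q × p = 0`, then `q = 0` and `p = 0`. -/
theorem galilean_critical_points_first_family (m s : ℝ) (hm : m ≠ 0)
    (q p x : Fin 3 → ℝ) (hx : x ⬝ᵥ x = 1)
    (h1 : crossProduct p (crossProduct q p - s • x) + (2 * m ^ 2) • q = 0)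
    (h2 : crossProduct (crossProduct q p - s • x) q + (2 : ℝ) • p
        + ((m ^ 2)⁻¹ * (p ⬝ᵥ p)) • p = 0)
    (h3 : s • crossProduct (crossProduct q p - s • x) x = 0)
    (hqp : crossProduct q p = 0) :
    q = 0 ∧ p = 0 := by
  have hq : q = 0 := by
    have h := congrArg (q ⬝ᵥ ·) h1
    simp only [dotProduct_add, dotProduct_smul, dotProduct_zero, smul_eq_mul] at h
    rw [triple_product_permutation, triple_product_permutation, hqp, dotProduct_zero,
      zero_add] at h
    exact dotProduct_self_eq_zero.mp ((mul_eq_zero.mp h).resolve_left (by positivity))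
  refine ⟨hq, ?_⟩
  subst hq
  rw [map_zero, zero_add, ← add_smul] at h2
  have hp : 0 ≤ p ⬝ᵥ p := by simpa using dotProduct_star_self_nonneg p
  exact (smul_eq_zero.mp h2).resolve_left (by positivity)
end

section
/- Let m, s ∈ ℝ with m ≠ 0, s > 0, and s² > 4m². Let r > 0 be the real cube root of 4m²s (i.e. r³ = 4m²s), so that s > r. Let p, x ∈ ℝ³ satisfy ‖x‖ = 1, ⟨p, x⟩ = 0, and ‖p‖² = 2m²(s − r)/r, and set q = (r/(2m²))·(p × x). Then (q, p, x) satisfies the three critical-point equations: (1) p × (q × p − s·x) + 2m²·q = 0, (2) (q × p − s·x) × q + 2p + m⁻²‖p‖²·p = 0, and (3) s·((q × p − s·x) × x) = 0. -/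
open scoped Matrix

/-- Let `m, s ∈ ℝ` with `m ≠ 0`, `s > 0`, `s² > 4m²`. Let `r > 0` with
`r³ = 4m²s` (the real cube root). Let `p, x ∈ ℝ³` satisfy `‖x‖ = 1`, `⟨p, x⟩ = 0` and
`‖p‖² = 2m²(s − r)/r`, and set `q = (r/(2m²))·(p × x)`. Then `(q, p, x)` satisfies the
critical-point equations
(1) `p × (q × p − s·x) + 2m²·q = 0`,
(2) `(q × p − s·x) × q + 2p + m⁻²‖p‖²·p = 0`,
(3) `s·((q × p − s·x) × x) = 0`. -/
theorem galilean_critical_points_second_family (m s r : ℝ) (hm : m ≠ 0) (hs : 0 < s)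
    (hs2 : s ^ 2 > 4 * m ^ 2) (hr : 0 < r) (hr3 : r ^ 3 = 4 * m ^ 2 * s)
    (p x : Fin 3 → ℝ) (hx : x ⬝ᵥ x = 1) (hpx : p ⬝ᵥ x = 0)
    (hp : p ⬝ᵥ p = 2 * m ^ 2 * (s - r) / r)
    (q : Fin 3 → ℝ) (hq : q = (r / (2 * m ^ 2)) • crossProduct p x) :
    crossProduct p (crossProduct q p - s • x) + (2 * m ^ 2) • q = 0 ∧
    crossProduct (crossProduct q p - s • x) q + (2 : ℝ) • p
        + ((m ^ 2)⁻¹ * (p ⬝ᵥ p)) • p = 0 ∧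
    s • crossProduct (crossProduct q p - s • x) x = 0 := by
  have hm2 : m ^ 2 ≠ 0 := pow_ne_zero 2 hm
  have hJ : crossProduct q p - s • x = -(r • x) := by
    have hcoef : r / (2 * m ^ 2) * (2 * m ^ 2 * (s - r) / r) = s - r := by
      field_simp
    rw [hq, map_smul, LinearMap.smul_apply, cross_cross_eq_smul_sub_smul, hp,
      dotProduct_comm x p, hpx, zero_smul, sub_zero, smul_smul, hcoef, sub_smul]
    abel
  have hxq : crossProduct x q = (r / (2 * m ^ 2)) • p := by
    rw [hq, map_smul, cross_cross_eq_smul_sub_smul', hx, hpx, zero_smul, sub_zero, one_smul]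
  rw [hJ]
  refine ⟨?_, ?_, ?_⟩
  · rw [map_neg, map_smul, hq, smul_smul, mul_div_cancel₀ r (mul_ne_zero two_ne_zero hm2),
      neg_add_cancel]
  · rw [map_neg, LinearMap.neg_apply, map_smul, LinearMap.smul_apply, hxq, hp, smul_smul,
      ← neg_smul, ← add_smul, ← add_smul]
    have hcoef : -(r * (r / (2 * m ^ 2))) + 2 + (m ^ 2)⁻¹ * (2 * m ^ 2 * (s - r) / r) = 0 := by
      field_simp
      linear_combination -hr3
    rw [hcoef, zero_smul]
  · rw [map_neg, LinearMap.neg_apply, map_smul, LinearMap.smul_apply, cross_self, smul_zero,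
      neg_zero, smul_zero]
end

section
/- Let (V, ω) be a finite-dimensional real symplectic vector space, j a compatible complex structure on (V, ω), ξ ∈ End(V) with ω(ξx, y) + ω(x, ξy) = 0 for all x, y (i.e. ξ ∈ 𝔰𝔭(V, ω)), and A ∈ End(V) with A ∘ j = −j ∘ A. Then ¼·tr((ξ∘j − j∘ξ)∘j∘A) + ½·tr(A∘ξ) = 0. (This identity says that the map j ↦ j − j₀ is the momentum map, vanishing at j₀, for the conjugation action of Sp(V, ω) on the space of compatible complex structures, relative to the symplectic form Ω_j(A, B) = ¼ tr(A∘j∘B) and the pairing κ(α, ξ) = ½ tr(α∘ξ).) -/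
/-- Let `(V, ω)` be a finite-dimensional real symplectic vector space,
`j` a compatible complex structure on `(V, ω)`, `ξ ∈ 𝔰𝔭(V, ω)` (i.e. `ω(ξx, y) + ω(x, ξy) = 0`),
and `A ∈ End(V)` with `A∘j = −j∘A`. Then
`¼·tr((ξ∘j − j∘ξ)∘j∘A) + ½·tr(A∘ξ) = 0`.
This says that `j ↦ j − j₀` is the momentum map, vanishing at `j₀`, for the conjugation
action of `Sp(V, ω)` on compatible complex structures, relative to
`Ω_j(A, B) = ¼ tr(A∘j∘B)` and `κ(α, ξ) = ½ tr(α∘ξ)`. -/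
theorem siegel_momentum_map_identity {V : Type*} [AddCommGroup V] [Module ℝ V]
    [FiniteDimensional ℝ V]
    (ω : V →ₗ[ℝ] V →ₗ[ℝ] ℝ) (halt : ∀ x : V, ω x x = 0)
    (hnd : ∀ x : V, (∀ y : V, ω x y = 0) → x = 0)
    (j : Module.End ℝ V) (hj2 : j * j = -1)
    (hjω : ∀ x y : V, ω (j x) (j y) = ω x y)
    (hjpos : ∀ x : V, x ≠ 0 → 0 < ω x (j x))
    (ξ : Module.End ℝ V) (hξ : ∀ x y : V, ω (ξ x) y + ω x (ξ y) = 0)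
    (A : Module.End ℝ V) (hA : A * j = -(j * A)) :
    (1 / 4 : ℝ) * LinearMap.trace ℝ V ((ξ * j - j * ξ) * j * A)
      + (1 / 2 : ℝ) * LinearMap.trace ℝ V (A * ξ) = 0 := by
  have hξA : ξ * j * j * A = -(ξ * A) := by
    rw [mul_assoc ξ j j, hj2, mul_neg_one, neg_mul]
  have hjAj : ξ * j * A * j = ξ * A := by
    rw [mul_assoc _ A j, hA, mul_neg, ← mul_assoc, hξA, neg_neg]
  have hconj : LinearMap.trace ℝ V (j * ξ * j * A) = LinearMap.trace ℝ V (ξ * A) := by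
    rw [← hjAj, LinearMap.trace_mul_comm ℝ (ξ * j * A) j]
    simp only [mul_assoc]
  rw [sub_mul, sub_mul, map_sub, hconj, hξA, map_neg, LinearMap.trace_mul_comm ℝ A ξ]
  ring
end

section
/- Let (V, ω) be a finite-dimensional real symplectic vector space and j₀, j two compatible complex structures on (V, ω). Assume j + j₀ is invertible, set S = (j + j₀)⁻¹(j − j₀), and assume 1 − t²S² is invertible for every t ∈ [0, 1]. Then for every A ∈ End(V) with A ∘ j = −j ∘ A: ∫₀¹ 2t · tr(S (1 − t²S²)⁻² (j + j₀)⁻¹ A (j + j₀)⁻¹) dt = ¼ tr(S A). -/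
section IntegralOfResolvent

variable {B : Type*} [NormedRing B] [NormedAlgebra ℝ B] [CompleteSpace B]

theorem hasDerivAt_ringInverse_one_sub_smul {x : B} {t : ℝ}
    (h : IsUnit (1 - t ^ 2 • x)) :
    HasDerivAt (fun s : ℝ => Ring.inverse (1 - s ^ 2 • x))
      (Ring.inverse (1 - t ^ 2 • x) * ((2 * t) • x) * Ring.inverse (1 - t ^ 2 • x)) t := by
  obtain ⟨u, hu⟩ := h
  have h₁ : HasDerivAt (fun s : ℝ => (1 : B) - s ^ 2 • x) (-((2 * t) • x)) t := by
    simpa using (((hasDerivAt_id t).pow 2).smul_const x).const_sub 1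
  have h₂ := hasFDerivAt_ringInverse (𝕜 := ℝ) u
  rw [hu] at h₂
  have h₃ := h₂.comp_hasDerivAt t h₁
  rw [← hu, Ring.inverse_unit]
  refine HasDerivAt.congr_deriv (f := Ring.inverse ∘ fun s : ℝ => 1 - s ^ 2 • x) h₃ ?_
  simp

theorem hasDerivAt_sq_smul_ringInverse_one_sub_smul {x : B} {t : ℝ}
    (h : IsUnit (1 - t ^ 2 • x)) :
    HasDerivAt (fun s : ℝ => s ^ 2 • Ring.inverse (1 - s ^ 2 • x))
      ((2 * t) • Ring.inverse (1 - t ^ 2 • x) ^ 2) t := by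
  have h₁ : HasDerivAt (fun s : ℝ => s ^ 2) (2 * t) t := by
    simpa using hasDerivAt_pow 2 t
  refine (h₁.smul (hasDerivAt_ringInverse_one_sub_smul h)).congr_deriv ?_
  set r := Ring.inverse (1 - t ^ 2 • x)
  have h₂ : r * (1 - t ^ 2 • x) = 1 := Ring.inverse_mul_cancel _ h
  have h₃ : t ^ 2 • (r * x) = r - 1 := by
    rw [mul_sub, mul_one, mul_smul_comm] at h₂
    rw [← h₂]; abel
  have h₄ : t ^ 2 • (r * ((2 * t) • x) * r) = (2 * t) • ((t ^ 2 • (r * x)) * r) := by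
    simp only [mul_smul_comm, smul_mul_assoc]
    rw [smul_comm]
  rw [h₄, h₃, sub_mul, one_mul, smul_sub, sq]
  abel

theorem integral_two_mul_apply_sq_ringInverse_one_sub_smul {x : B} (l : B →L[ℝ] ℝ)
    (h : ∀ t ∈ Set.Icc (0 : ℝ) 1, IsUnit (1 - t ^ 2 • x)) :
    ∫ t in (0 : ℝ)..1, 2 * t * l (Ring.inverse (1 - t ^ 2 • x) ^ 2)
      = l (Ring.inverse (1 - x)) := by
  have h' : ∀ t ∈ Set.uIcc (0 : ℝ) 1, IsUnit (1 - t ^ 2 • x) := by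
    simpa [Set.uIcc_of_le] using h
  have hd : ∀ t ∈ Set.uIcc (0 : ℝ) 1,
      HasDerivAt (fun s : ℝ => l (s ^ 2 • Ring.inverse (1 - s ^ 2 • x)))
        (2 * t * l (Ring.inverse (1 - t ^ 2 • x) ^ 2)) t := by
    intro t ht
    refine HasDerivAt.congr_deriv (l.hasFDerivAt.comp_hasDerivAt t
      (hasDerivAt_sq_smul_ringInverse_one_sub_smul (h' t ht))) ?_
    simp
  have hc : ContinuousOn (fun t : ℝ => 2 * t * l (Ring.inverse (1 - t ^ 2 • x) ^ 2))
      (Set.uIcc 0 1) := by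
    intro t ht
    have := (hasDerivAt_ringInverse_one_sub_smul (h' t ht)).continuousAt
    exact ((continuousAt_const.mul continuousAt_id).mul
      (l.continuous.continuousAt.comp (this.pow 2))).continuousWithinAt
  rw [intervalIntegral.integral_eq_sub_of_hasDerivAt hd hc.intervalIntegrable]
  simp

end IntegralOfResolvent

theorem MulEquiv.map_ringInverse {M N : Type*} [MonoidWithZero M] [MonoidWithZero N]
    (e : M ≃* N) {a : M} (ha : IsUnit a) : e (Ring.inverse a) = Ring.inverse (e a) := by
  obtain ⟨u, rfl⟩ := ha
  rw [Ring.inverse_unit]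
  exact (Ring.inverse_unit (Units.map e.toMonoidHom u)).symm

attribute [local instance] Matrix.linftyOpNormedRing Matrix.linftyOpNormedAlgebra in
theorem Module.End.integral_two_mul_apply_sq_ringInverse_one_sub_smul {V : Type*}
    [AddCommGroup V] [Module ℝ V] [FiniteDimensional ℝ V] {x : Module.End ℝ V}
    (l : Module.End ℝ V →ₗ[ℝ] ℝ) (h : ∀ t ∈ Set.Icc (0 : ℝ) 1, IsUnit (1 - t ^ 2 • x)) :
    ∫ t in (0 : ℝ)..1, 2 * t * l (Ring.inverse (1 - t ^ 2 • x) ^ 2)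
      = l (Ring.inverse (1 - x)) := by
  let e := LinearMap.toMatrixAlgEquiv (Module.finBasis ℝ V)
  let m := LinearMap.toContinuousLinearMap (l ∘ₗ e.symm.toLinearMap)
  have hm : ∀ y, l y = m (e y) := fun y => by simp [m]
  have he : ∀ t ∈ Set.Icc (0 : ℝ) 1,
      e (Ring.inverse (1 - t ^ 2 • x)) = Ring.inverse (1 - t ^ 2 • e x) := by
    intro t ht
    have := MulEquiv.map_ringInverse e.toMulEquiv (h t ht)
    simpa using this
  have hu : ∀ t ∈ Set.Icc (0 : ℝ) 1, IsUnit (1 - t ^ 2 • e x) := by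
    intro t ht
    simpa using (h t ht).map e
  have h₁ : e (Ring.inverse (1 - x)) = Ring.inverse (1 - e x) := by
    simpa using he 1 (by simp)
  rw [hm, h₁]
  refine Eq.trans (intervalIntegral.integral_congr fun t ht => ?_)
    (_root_.integral_two_mul_apply_sq_ringInverse_one_sub_smul m hu)
  rw [Set.uIcc_of_le zero_le_one] at ht
  simp only [hm, map_pow, he t ht]
  rfl

/-- The endomorphism `S = (j + j₀)⁻¹(j - j₀)` satisfies
`(j + j₀)⁻¹ S (1 - S²)⁻¹ (j + j₀)⁻¹ = S / 4`. -/
theorem cayley_transform_sandwich {R : Type*} [Ring R] {j₀ j p s r : R}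
    (hj₀ : j₀ * j₀ = -1) (hj : j * j = -1)
    (hp : p * (j + j₀) = 1) (hp' : (j + j₀) * p = 1) (hs : s = p * (j - j₀))
    (hr : r * (1 - s ^ 2) = 1) (hr' : (1 - s ^ 2) * r = 1) :
    4 * (p * s * r * p) = s := by
  have hpj₀ : p * j₀ = j * p := by
    have h₁ : j₀ * (j + j₀) = (j + j₀) * j := by rw [mul_add, add_mul, hj₀, hj]; abel
    calc p * j₀ = p * (j₀ * (j + j₀)) * p := by rw [mul_assoc, mul_assoc, hp', mul_one]
      _ = j * p := by rw [h₁, ← mul_assoc, hp, one_mul]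
  have hpj : p * j = j₀ * p := by
    have h₁ : j * (j + j₀) = (j + j₀) * j₀ := by rw [mul_add, add_mul, hj₀, hj]; abel
    calc p * j = p * (j * (j + j₀)) * p := by rw [mul_assoc, mul_assoc, hp', mul_one]
      _ = j₀ * p := by rw [h₁, ← mul_assoc, hp, one_mul]
  have hsj₀ : j₀ * s = -(s * j₀) := by
    rw [hs, ← mul_assoc, ← hpj, mul_assoc, mul_assoc, ← mul_neg]
    congr 1
    rw [mul_sub, sub_mul, hj, hj₀]; abel
  have hsub : 1 - s = 2 * (p * j₀) := by
    rw [hs, ← hp]; noncomm_ring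
  have h2p : 2 * p = -((1 - s) * j₀) := by
    rw [hsub, mul_assoc, mul_assoc, hj₀]; noncomm_ring
  have hs2 : Commute j₀ (1 - s ^ 2) := by
    refine (Commute.one_right j₀).sub_right ?_
    change j₀ * s ^ 2 = s ^ 2 * j₀
    rw [sq, ← mul_assoc, hsj₀, neg_mul, mul_assoc, hsj₀, mul_neg, neg_neg, mul_assoc]
  have hu : ∀ y : R, Commute y (1 - s ^ 2) → y * r = r * y := by
    intro y hy
    calc y * r = r * ((1 - s ^ 2) * y) * r := by rw [← mul_assoc, hr, one_mul]
      _ = r * y := by rw [← hy.eq, mul_assoc, mul_assoc, hr', mul_one]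
  have hj₀r : j₀ * r = r * j₀ := hu _ hs2
  have hsr : s * r = r * s :=
    hu _ ((Commute.one_right s).sub_right ((Commute.refl s).pow_right 2))
  calc 4 * (p * s * r * p) = (2 * p) * s * r * (2 * p) := by noncomm_ring
    _ = (1 - s) * (j₀ * s) * r * (1 - s) * j₀ := by rw [h2p]; noncomm_ring
    _ = -((1 - s) * s * (j₀ * r) * (1 - s) * j₀) := by rw [hsj₀]; noncomm_ring
    _ = -((1 - s) * (s * r) * (j₀ * j₀ - (j₀ * s) * j₀)) := by rw [hj₀r]; noncomm_ring
    _ = (1 - s) * (s * r) * (1 + s) := by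
      rw [hsj₀, neg_mul, mul_assoc s, hj₀]; noncomm_ring
    _ = s * r * (1 - s ^ 2) := by
      have : (1 - s) * (s * r) = s * r * (1 - s) := by
        rw [sub_mul, mul_sub, mul_assoc s r s, ← hsr]; noncomm_ring
      rw [this]; noncomm_ring
    _ = s := by rw [mul_assoc, hr, mul_one]


/-- Let `(V, ω)` be a finite-dimensional real symplectic vector space and
`j₀, j` two compatible complex structures on `(V, ω)`. Assume `j + j₀` is invertible, set
`S = (j + j₀)⁻¹(j − j₀)`, and assume `1 − t²S²` is invertible for every `t ∈ [0, 1]`.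
Then for every `A ∈ End(V)` with `A∘j = −j∘A`:
`∫₀¹ 2t · tr(S (1 − t²S²)⁻² (j + j₀)⁻¹ A (j + j₀)⁻¹) dt = ¼ tr(S A)`. -/
theorem cayley_contraction_integral {V : Type*} [AddCommGroup V] [Module ℝ V]
    [FiniteDimensional ℝ V]
    (ω : V →ₗ[ℝ] V →ₗ[ℝ] ℝ) (halt : ∀ x : V, ω x x = 0)
    (hnd : ∀ x : V, (∀ y : V, ω x y = 0) → x = 0)
    (j₀ j : Module.End ℝ V)
    (hj₀2 : j₀ * j₀ = -1) (hj₀ω : ∀ x y : V, ω (j₀ x) (j₀ y) = ω x y)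
    (hj₀pos : ∀ x : V, x ≠ 0 → 0 < ω x (j₀ x))
    (hj2 : j * j = -1) (hjω : ∀ x y : V, ω (j x) (j y) = ω x y)
    (hjpos : ∀ x : V, x ≠ 0 → 0 < ω x (j x))
    (hsum : IsUnit (j + j₀))
    (S : Module.End ℝ V) (hS : S = Ring.inverse (j + j₀) * (j - j₀))
    (hinv : ∀ t ∈ Set.Icc (0 : ℝ) 1, IsUnit ((1 : Module.End ℝ V) - t ^ 2 • S ^ 2))
    (A : Module.End ℝ V) (hA : A * j = -(j * A)) :
    ∫ t in (0 : ℝ)..1,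
        2 * t * LinearMap.trace ℝ V
          (S * (Ring.inverse ((1 : Module.End ℝ V) - t ^ 2 • S ^ 2)) ^ 2
            * Ring.inverse (j + j₀) * A * Ring.inverse (j + j₀))
      = (1 / 4 : ℝ) * LinearMap.trace ℝ V (S * A) := by
  set P := Ring.inverse (j + j₀) with hP
  let l : Module.End ℝ V →ₗ[ℝ] ℝ :=
    LinearMap.trace ℝ V ∘ₗ LinearMap.mulLeft ℝ S ∘ₗ LinearMap.mulRight ℝ (P * A * P)
  have hl : ∀ y, l y = LinearMap.trace ℝ V (S * y * P * A * P) := fun y => by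
    simp [l, mul_assoc]
  have hu : IsUnit ((1 : Module.End ℝ V) - S ^ 2) := by simpa using hinv 1 (by simp)
  simp only [← hl]
  rw [Module.End.integral_two_mul_apply_sq_ringInverse_one_sub_smul l hinv, hl]
  have h := cayley_transform_sandwich hj₀2 hj2 (Ring.inverse_mul_cancel _ hsum)
    (Ring.mul_inverse_cancel _ hsum) hS (Ring.inverse_mul_cancel _ hu)
    (Ring.mul_inverse_cancel _ hu)
  rw [← hP] at h
  set r := Ring.inverse ((1 : Module.End ℝ V) - S ^ 2)
  have h' : S = (4 : ℝ) • (P * S * r * P) := by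
    simp [ofNat_smul_eq_nsmul, nsmul_eq_mul, h]
  have h₄ : LinearMap.trace ℝ V (S * A) = 4 * LinearMap.trace ℝ V (P * S * r * P * A) := by
    conv_lhs => rw [h']
    rw [smul_mul_assoc, map_smul, smul_eq_mul]
  rw [h₄, LinearMap.trace_mul_comm, ← mul_assoc, ← mul_assoc, ← mul_assoc, ← mul_assoc]
  ring
end

section
/- Let φ₁, φ₂, φ₃: ℝ → ℝ be smooth functions with φᵢ'(x) > 0 and φᵢ(x+1) = φᵢ(x) + 1 for all x (lifts of orientation-preserving circle diffeomorphisms). Define the Bott–Thurston cochain c(φ, ψ) = ½ ∫₀¹ log((φ∘ψ)'(t)) · (ψ''(t)/ψ'(t)) dt. Then c satisfies the group 2-cocycle identity with respect to composition: c(φ₁, φ₂) + c(φ₁∘φ₂, φ₃) = c(φ₂, φ₃) + c(φ₁, φ₂∘φ₃). -/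
/-- The Bott–Thurston cochain
`c(φ, ψ) = ½ ∫₀¹ log((φ∘ψ)'(t)) · (ψ''(t)/ψ'(t)) dt`. -/
noncomputable def bottThurstonCochain (φ ψ : ℝ → ℝ) : ℝ :=
  (1 / 2 : ℝ) * ∫ t in (0 : ℝ)..1, Real.log (deriv (φ ∘ ψ) t) * (deriv (deriv ψ) t / deriv ψ t)

/-- The logarithmic derivative `t ↦ log (φ'(t))` occurring in the Bott–Thurston cochain. -/
noncomputable def logDerivative (φ : ℝ → ℝ) (t : ℝ) : ℝ := Real.log (deriv φ t)

theorem contDiff_logDerivative {φ : ℝ → ℝ} (h : ContDiff ℝ (⊤ : ℕ∞) φ)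
    (h' : ∀ x, 0 < deriv φ x) : ContDiff ℝ (⊤ : ℕ∞) (logDerivative φ) :=
  (contDiff_infty_iff_deriv.1 h).2.log fun x => (h' x).ne'

theorem deriv_logDerivative {φ : ℝ → ℝ} (h : ContDiff ℝ (⊤ : ℕ∞) φ)
    (h' : ∀ x, 0 < deriv φ x) (t : ℝ) :
    deriv (logDerivative φ) t = deriv (deriv φ) t / deriv φ t :=
  deriv.log ((contDiff_infty_iff_deriv.1 (contDiff_infty_iff_deriv.1 h).2).1 t) (h' t).ne'

theorem deriv_comp_pos {φ ψ : ℝ → ℝ} (hφ : Differentiable ℝ φ) (hψ : Differentiable ℝ ψ)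
    (hφ' : ∀ x, 0 < deriv φ x) (hψ' : ∀ x, 0 < deriv ψ x) (x : ℝ) : 0 < deriv (φ ∘ ψ) x := by
  rw [deriv_comp x (hφ _) (hψ x)]
  exact mul_pos (hφ' _) (hψ' x)

theorem logDerivative_comp {φ ψ : ℝ → ℝ} (hφ : Differentiable ℝ φ) (hψ : Differentiable ℝ ψ)
    (hφ' : ∀ x, 0 < deriv φ x) (hψ' : ∀ x, 0 < deriv ψ x) :
    logDerivative (φ ∘ ψ) = fun t => logDerivative φ (ψ t) + logDerivative ψ t := by
  ext t
  simp only [logDerivative]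
  rw [deriv_comp t (hφ _) (hψ t), Real.log_mul (hφ' _).ne' (hψ' t).ne']

theorem logDerivative_periodic {φ : ℝ → ℝ} (hp : ∀ x, φ (x + 1) = φ x + 1) :
    Function.Periodic (logDerivative φ) 1 := by
  intro x
  simp only [logDerivative]
  rw [← deriv_comp_add_const, funext hp, deriv_add_const]

theorem Function.Periodic.deriv_periodic {f : ℝ → ℝ} {c : ℝ} (hf : Function.Periodic f c) :
    Function.Periodic (deriv f) c := by
  intro x
  rw [← deriv_comp_add_const, funext hf]

theorem bottThurstonCochain_eq_integral {φ ψ : ℝ → ℝ} (hψ : ContDiff ℝ (⊤ : ℕ∞) ψ)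
    (hψ' : ∀ x, 0 < deriv ψ x) :
    bottThurstonCochain φ ψ =
      1 / 2 * ∫ t in (0 : ℝ)..1, logDerivative (φ ∘ ψ) t * deriv (logDerivative ψ) t := by
  simp only [bottThurstonCochain, deriv_logDerivative hψ hψ']
  rfl

/-- Integrals of 1-periodic functions are invariant under lifts of circle diffeomorphisms. -/
theorem integral_comp_mul_deriv_of_periodic {f φ : ℝ → ℝ} (hf : Continuous f)
    (hfp : Function.Periodic f 1) (h : ContDiff ℝ (⊤ : ℕ∞) φ)
    (hp : ∀ x, φ (x + 1) = φ x + 1) :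
    ∫ t in (0 : ℝ)..1, f (φ t) * deriv φ t = ∫ t in (0 : ℝ)..1, f t := by
  have hd := contDiff_infty_iff_deriv.1 h
  have hsub := intervalIntegral.integral_comp_mul_deriv (a := 0) (b := 1)
    (fun x _ => (hd.1 x).hasDerivAt) hd.2.continuous.continuousOn hf
  have hend : φ 1 = φ 0 + 1 := by simpa using hp 0
  have hper := hfp.intervalIntegral_add_eq (φ 0) 0
  rw [zero_add] at hper
  rw [← hper, ← hend, ← hsub]
  rfl

/-- The integral over a period of the derivative of `g ^ 2 / 2 + b * g` vanishes. -/
theorem integral_add_mul_deriv_add_mul_deriv_eq_zero {b g : ℝ → ℝ}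
    (hb : ContDiff ℝ (⊤ : ℕ∞) b) (hg : ContDiff ℝ (⊤ : ℕ∞) g)
    (hb01 : b 1 = b 0) (hg01 : g 1 = g 0) :
    ∫ t in (0 : ℝ)..1, ((b t + g t) * deriv g t + g t * deriv b t) = 0 := by
  have hbd := contDiff_infty_iff_deriv.1 hb
  have hgd := contDiff_infty_iff_deriv.1 hg
  have hcb := hbd.2.continuous
  have hcg := hgd.2.continuous
  have hb0 := hb.continuous
  have hg0 := hg.continuous
  rw [intervalIntegral.integral_eq_sub_of_hasDerivAt (f := fun t => g t ^ 2 / 2 + b t * g t)]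
  · simp [hb01, hg01]
  · intro t _
    have hgt := (hgd.1 t).hasDerivAt
    exact (((hgt.fun_pow 2).div_const 2).fun_add ((hbd.1 t).hasDerivAt.fun_mul hgt)).congr_deriv
      (by norm_num; ring)
  · exact Continuous.intervalIntegrable (by fun_prop) _ _

/-- Let `φ₁, φ₂, φ₃ : ℝ → ℝ` be smooth with `φᵢ' > 0` and
`φᵢ(x+1) = φᵢ(x) + 1` (lifts of orientation-preserving circle diffeomorphisms). Then the
Bott–Thurston cochain satisfies the group 2-cocycle identity with respect to composition:
`c(φ₁, φ₂) + c(φ₁∘φ₂, φ₃) = c(φ₂, φ₃) + c(φ₁, φ₂∘φ₃)`. -/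
theorem bottThurston_two_cocycle (φ₁ φ₂ φ₃ : ℝ → ℝ)
    (h₁ : ContDiff ℝ (⊤ : ℕ∞) φ₁) (h₂ : ContDiff ℝ (⊤ : ℕ∞) φ₂) (h₃ : ContDiff ℝ (⊤ : ℕ∞) φ₃)
    (h₁' : ∀ x : ℝ, 0 < deriv φ₁ x) (h₂' : ∀ x : ℝ, 0 < deriv φ₂ x)
    (h₃' : ∀ x : ℝ, 0 < deriv φ₃ x)
    (h₁p : ∀ x : ℝ, φ₁ (x + 1) = φ₁ x + 1) (h₂p : ∀ x : ℝ, φ₂ (x + 1) = φ₂ x + 1)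
    (h₃p : ∀ x : ℝ, φ₃ (x + 1) = φ₃ x + 1) :
    bottThurstonCochain φ₁ φ₂ + bottThurstonCochain (φ₁ ∘ φ₂) φ₃
      = bottThurstonCochain φ₂ φ₃ + bottThurstonCochain φ₁ (φ₂ ∘ φ₃) := by
  have d₁ := (contDiff_infty_iff_deriv.1 h₁).1
  have d₂ := (contDiff_infty_iff_deriv.1 h₂).1
  have d₃ := (contDiff_infty_iff_deriv.1 h₃).1
  have d₁₂ := d₁.comp d₂
  have h₁₂' := deriv_comp_pos d₁ d₂ h₁' h₂'
  have h₂₃' := deriv_comp_pos d₂ d₃ h₂' h₃'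
  have hl₁ := contDiff_logDerivative h₁ h₁'
  have hl₂ := contDiff_logDerivative h₂ h₂'
  have hl₃ := contDiff_logDerivative h₃ h₃'
  have hp₁₂ : ∀ x, (φ₁ ∘ φ₂) (x + 1) = (φ₁ ∘ φ₂) x + 1 := fun x => by
    simp [h₂p, h₁p]
  have hl₁₂ := contDiff_logDerivative (h₁.comp h₂) h₁₂'
  have hcl₂ := (contDiff_infty_iff_deriv.1 hl₂).2.continuous
  have hsubst : (∫ t in (0 : ℝ)..1,
      logDerivative (φ₁ ∘ φ₂) (φ₃ t) * deriv (logDerivative φ₂) (φ₃ t) * deriv φ₃ t) =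
      ∫ t in (0 : ℝ)..1, logDerivative (φ₁ ∘ φ₂) t * deriv (logDerivative φ₂) t :=
    integral_comp_mul_deriv_of_periodic (hl₁₂.continuous.mul hcl₂)
      ((logDerivative_periodic hp₁₂).mul (logDerivative_periodic h₂p).deriv_periodic) h₃ h₃p
  rw [bottThurstonCochain_eq_integral h₂ h₂', bottThurstonCochain_eq_integral h₃ h₃',
    bottThurstonCochain_eq_integral h₃ h₃', bottThurstonCochain_eq_integral (h₂.comp h₃) h₂₃',
    ← hsubst, ← Function.comp_assoc, logDerivative_comp d₁₂ d₃ h₁₂' h₃', logDerivative_comp d₁ d₂ h₁' h₂',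
    logDerivative_comp d₂ d₃ h₂' h₃']
  set g := logDerivative φ₃
  set b : ℝ → ℝ := logDerivative φ₂ ∘ φ₃ with hb
  set a : ℝ → ℝ := fun t => logDerivative φ₁ (φ₂ (φ₃ t))
  have hbs : ContDiff ℝ (⊤ : ℕ∞) b := hl₂.comp h₃
  have has : ContDiff ℝ (⊤ : ℕ∞) a := hl₁.comp (h₂.comp h₃)
  have hbd := contDiff_infty_iff_deriv.1 hbs
  have hgd := contDiff_infty_iff_deriv.1 hl₃
  have hb' : ∀ t, deriv b t = deriv (logDerivative φ₂) (φ₃ t) * deriv φ₃ t := fun t =>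
    deriv_comp t ((contDiff_infty_iff_deriv.1 hl₂).1 _) (d₃ t)
  have hbg' : ∀ t, deriv (fun t => logDerivative φ₂ (φ₃ t) + g t) t = deriv b t + deriv g t :=
    fun t => deriv_add (hbd.1 t) (hgd.1 t)
  have hg01 : g 1 = g 0 := by simpa using logDerivative_periodic h₃p 0
  have hb01 : b 1 = b 0 := by
    have h01 : φ₃ 1 = φ₃ 0 + 1 := by simpa using h₃p 0
    simpa [hb, h01] using logDerivative_periodic h₂p (φ₃ 0)
  have hzero := integral_add_mul_deriv_add_mul_deriv_eq_zero hbs hl₃ hb01 hg01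
  have hca := has.continuous
  have hcb := hbs.continuous
  have hcg := hl₃.continuous
  have hcb' := hbd.2.continuous
  have hcg' := hgd.2.continuous
  have hcancel : (∫ t in (0 : ℝ)..1, (a t + b t) * deriv b t) +
      (∫ t in (0 : ℝ)..1, (a t + b t + g t) * deriv g t) +
      (∫ t in (0 : ℝ)..1, ((b t + g t) * deriv g t + g t * deriv b t)) =
      (∫ t in (0 : ℝ)..1, (b t + g t) * deriv g t) +
      ∫ t in (0 : ℝ)..1, (a t + b t + g t) * (deriv b t + deriv g t) := by
    rw [← intervalIntegral.integral_add, ← intervalIntegral.integral_add,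
      ← intervalIntegral.integral_add]
    · congr 1
      ext t
      ring
    all_goals exact Continuous.intervalIntegrable (by fun_prop) _ _
  rw [hzero, add_zero] at hcancel
  simp only [hbg', mul_assoc, ← hb', ← mul_add]
  exact congrArg (1 / 2 * ·) hcancel
end
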